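/- Let f : ℝ → ℝ be locally integrable on (0, ∞) and suppose that for every a > 0 and all 0 < x ≤ y, ∫_{ax}^{ay} f(t) dt = ∫_x^y f(t) dt. Then there exists a constant c such that f(t) = c/t for almost every t ∈ (0, ∞). -/

import Mathlib

open MeasureTheory

/-- A locally integrable function on `(0, ∞)` is interval integrable between positive reals. -/
lemma intervalIntegrable_of_locallyIntegrableOn_Ioi {f : ℝ → ℝ}
    (hf : LocallyIntegrableOn f (Set.Ioi (0 : ℝ)) volume) {x y : ℝ} (hx : 0 < x) (hy : 0 < y) :
    IntervalIntegrable f volume x y := by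
  rw [intervalIntegrable_iff']
  exact hf.integrableOn_compact_subset (fun t ht ↦ lt_of_lt_of_le (lt_min hx hy) ht.1)
    isCompact_uIcc

/-- Lebesgue differentiation for a primitive, based at `1`, of a locally integrable function
on `(0, ∞)`. -/
lemma ae_hasDerivAt_integral_of_locallyIntegrableOn_Ioi {f : ℝ → ℝ}
    (hf : LocallyIntegrableOn f (Set.Ioi (0 : ℝ)) volume) :
    ∀ᵐ x, 0 < x → HasDerivAt (fun y ↦ ∫ t in (1 : ℝ)..y, f t) (f x) x := by
  have key : ∀ n : ℕ, ∀ᵐ x, x ∈ Set.uIcc (1 / ((n : ℝ) + 1)) ((n : ℝ) + 1) →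
      HasDerivAt (fun y ↦ ∫ t in (1 : ℝ)..y, f t) (f x) x := by
    intro n
    have hn : (0 : ℝ) < (n : ℝ) + 1 := by positivity
    have hn1 : (1 : ℝ) ≤ (n : ℝ) + 1 := by simp
    have h1 : 1 / ((n : ℝ) + 1) ≤ 1 := by rw [div_le_one hn]; exact hn1
    have hint := intervalIntegrable_of_locallyIntegrableOn_Ioi hf (one_div_pos.2 hn) hn
    filter_upwards [hint.ae_hasDerivAt_integral] with x hx hxm
    exact hx hxm 1 (Set.mem_uIcc_of_le h1 hn1)
  filter_upwards [ae_all_iff.2 key] with x hx hx0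
  obtain ⟨n, hn⟩ := exists_nat_ge (max x (1 / x))
  have hxn : x ≤ n := (le_max_left _ _).trans hn
  have hxn' : 1 / x ≤ n := (le_max_right _ _).trans hn
  refine hx n (Set.mem_uIcc_of_le ?_ (by linarith))
  rw [one_div_le (by positivity) hx0]
  linarith

/-- If `f` is locally integrable on `(0, ∞)` and the measure `E ↦ ∫_E f` on `(0, ∞)` is
invariant under every positive scaling, then `f(t) = c/t` for almost every `t ∈ (0, ∞)`. -/
theorem eq_const_div_of_scale_invariant (f : ℝ → ℝ)
    (hf : LocallyIntegrableOn f (Set.Ioi (0 : ℝ)) volume)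
    (h : ∀ a : ℝ, 0 < a → ∀ x y : ℝ, 0 < x → x ≤ y →
      ∫ t in (a * x)..(a * y), f t = ∫ t in x..y, f t) :
    ∃ c : ℝ, ∀ᵐ t ∂(volume.restrict (Set.Ioi (0 : ℝ))), f t = c / t := by
  have hae := ae_hasDerivAt_integral_of_locallyIntegrableOn_Ioi hf
  have hint {x y : ℝ} (hx : 0 < x) (hy : 0 < y) :=
    intervalIntegrable_of_locallyIntegrableOn_Ioi hf hx hy
  have hscale : ∀ a x y : ℝ, 0 < a → 0 < x → 0 < y →
      ∫ t in (a * x)..(a * y), f t = ∫ t in x..y, f t := by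
    intro a x y ha hx hy
    rcases le_total x y with hxy | hxy
    · exact h a ha x y hx hxy
    · rw [intervalIntegral.integral_symm, h a ha y x hy hxy, ← intervalIntegral.integral_symm]
  obtain ⟨x₀, hx₀, hd₀⟩ : ∃ x₀ : ℝ, 0 < x₀ ∧
      HasDerivAt (fun y ↦ ∫ t in (1 : ℝ)..y, f t) (f x₀) x₀ := by
    have : NeZero (volume.restrict (Set.Ioi (0 : ℝ))) := ⟨by simp⟩
    obtain ⟨x₀, hx₀⟩ := ((ae_restrict_iff' measurableSet_Ioi).2 hae).and
      (ae_restrict_mem measurableSet_Ioi) |>.exists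
    exact ⟨x₀, hx₀.2, hx₀.1⟩
  refine ⟨f x₀ * x₀, (ae_restrict_iff' measurableSet_Ioi).2 ?_⟩
  filter_upwards [hae] with x hx hx0
  have hx0 : 0 < x := hx0
  set a := x₀ / x with ha_def
  have ha : 0 < a := div_pos hx₀ hx0
  have hax : a * x = x₀ := div_mul_cancel₀ x₀ hx0.ne'
  have hd : HasDerivAt (fun y ↦ (∫ t in (1 : ℝ)..a * y, f t) - ∫ t in (1 : ℝ)..a, f t)
      (f x₀ * a) x := by
    have h1 : HasDerivAt (fun y ↦ a * y) a x := by
      simpa using (hasDerivAt_id x).const_mul a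
    rw [← hax] at hd₀
    have h2 := (hd₀.comp x h1).sub_const (∫ t in (1 : ℝ)..a, f t)
    rwa [hax] at h2
  have heq : (fun y ↦ ∫ t in (1 : ℝ)..y, f t) =ᶠ[nhds x]
      fun y ↦ (∫ t in (1 : ℝ)..a * y, f t) - ∫ t in (1 : ℝ)..a, f t := by
    filter_upwards [lt_mem_nhds hx0] with y hy
    rw [intervalIntegral.integral_interval_sub_left (hint one_pos (mul_pos ha hy))
      (hint one_pos ha)]
    simpa using (hscale a 1 y ha one_pos hy).symm
  rw [(hx hx0).unique (hd.congr_of_eventuallyEq heq), ha_def, mul_div_assoc]
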